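/- Let 0 < p < ∞ and let U₁ and U₂ be unitary operators on a separable Hilbert space with U₁ − U₂ ∈ S_p. Then there exists a unitary operator V such that ‖U₁ − V‖_{S_p} ≤ (π/4)·‖U₁ − U₂‖_{S_p} and ‖U₂ − V‖_{S_p} ≤ (π/4)·‖U₁ − U₂‖_{S_p}. -/

import Mathlib

open scoped BigOperators
noncomputable section

/-- The `j`-th singular value of a bounded operator `T` on a Hilbert space:
`s_j(T) = inf {‖T - R‖ : rank R ≤ j}`. -/
def sVal {H : Type} [NormedAddCommGroup H] [InnerProductSpace ℂ H] [CompleteSpace H]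
    (T : H →L[ℂ] H) (j : ℕ) : ℝ :=
  sInf {c : ℝ | ∃ R : H →L[ℂ] H, LinearMap.rank (R : H →ₗ[ℂ] H) ≤ (j : Cardinal) ∧ c = ‖T - R‖}

/-- Membership in the Schatten–von Neumann class `S_p`. -/
def MemSchatten {H : Type} [NormedAddCommGroup H] [InnerProductSpace ℂ H] [CompleteSpace H]
    (p : ℝ) (T : H →L[ℂ] H) : Prop :=
  Summable fun j : ℕ => sVal T j ^ p

/-- The Schatten–von Neumann norm `‖T‖_{S_p} = (∑_{j ≥ 0} s_j(T)^p)^{1/p}`. -/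
def schNorm {H : Type} [NormedAddCommGroup H] [InnerProductSpace ℂ H] [CompleteSpace H]
    (p : ℝ) (T : H →L[ℂ] H) : ℝ :=
  (∑' j : ℕ, sVal T j ^ p) ^ (1 / p)

theorem isCompactOperator_of_rank_le {H : Type*} [NormedAddCommGroup H]
    [InnerProductSpace ℂ H] {R : H →L[ℂ] H} {j : ℕ}
    (hR : LinearMap.rank (R : H →ₗ[ℂ] H) ≤ (j : Cardinal)) : IsCompactOperator R := by
  have : FiniteDimensional ℂ (LinearMap.range (R : H →ₗ[ℂ] H)) :=
    Module.rank_lt_aleph0_iff.mp (lt_of_le_of_lt hR Cardinal.natCast_lt_aleph0)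
  have : LocallyCompactSpace (LinearMap.range (R : H →ₗ[ℂ] H)) :=
    have := FiniteDimensional.proper ℂ (LinearMap.range (R : H →ₗ[ℂ] H))
    inferInstance
  exact (isCompactOperator_of_locallyCompactSpace_dom
    (R.codRestrict (LinearMap.range (R : H →ₗ[ℂ] H)) fun x => ⟨x, rfl⟩)).clm_comp
    (LinearMap.range (R : H →ₗ[ℂ] H)).subtypeL

section SingularValues

variable {H : Type} [NormedAddCommGroup H] [InnerProductSpace ℂ H] [CompleteSpace H]

theorem sVal_nonneg (T : H →L[ℂ] H) (j : ℕ) : 0 ≤ sVal T j := by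
  apply Real.sInf_nonneg
  rintro c ⟨R, -, rfl⟩
  exact norm_nonneg _

theorem sVal_le_norm_sub {T R : H →L[ℂ] H} {j : ℕ}
    (hR : LinearMap.rank (R : H →ₗ[ℂ] H) ≤ (j : Cardinal)) : sVal T j ≤ ‖T - R‖ := by
  refine csInf_le ⟨0, ?_⟩ ⟨R, hR, rfl⟩
  rintro c ⟨R, -, rfl⟩
  exact norm_nonneg _

theorem exists_norm_sub_lt_of_sVal_lt {T : H →L[ℂ] H} {j : ℕ} {c : ℝ} (h : sVal T j < c) :
    ∃ R : H →L[ℂ] H, LinearMap.rank (R : H →ₗ[ℂ] H) ≤ (j : Cardinal) ∧ ‖T - R‖ < c := by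
  obtain ⟨_, ⟨R, hR, rfl⟩, hlt⟩ := exists_lt_of_csInf_lt (s := {c : ℝ | ∃ R : H →L[ℂ] H,
    LinearMap.rank (R : H →ₗ[ℂ] H) ≤ (j : Cardinal) ∧ c = ‖T - R‖})
    ⟨‖T - 0‖, 0, by simp [LinearMap.rank_zero], rfl⟩ h
  exact ⟨R, hR, hlt⟩

theorem sVal_mul_le (T Z : H →L[ℂ] H) {c : ℝ} (hZ : ‖Z‖ ≤ c) (j : ℕ) :
    sVal (T * Z) j ≤ c * sVal T j := by
  have hc : 0 ≤ c := (norm_nonneg Z).trans hZ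
  refine le_of_forall_pos_le_add fun ε hε => ?_
  obtain ⟨R, hR, hlt⟩ := exists_norm_sub_lt_of_sVal_lt
    (lt_add_of_pos_right (sVal T j) (show 0 < ε / (c + 1) by positivity))
  calc sVal (T * Z) j ≤ ‖T * Z - R * Z‖ :=
        sVal_le_norm_sub ((LinearMap.rank_comp_le_left (Z : H →ₗ[ℂ] H) (R : H →ₗ[ℂ] H)).trans hR)
    _ = ‖(T - R) * Z‖ := by rw [sub_mul]
    _ ≤ ‖T - R‖ * ‖Z‖ := norm_mul_le _ _
    _ ≤ (sVal T j + ε / (c + 1)) * c := mul_le_mul hlt.le hZ (norm_nonneg Z)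
        ((norm_nonneg _).trans hlt.le)
    _ = c * sVal T j + ε * (c / (c + 1)) := by ring
    _ ≤ c * sVal T j + ε := by
        gcongr
        exact mul_le_of_le_one_right hε.le (div_le_one_of_le₀ (by linarith) (by linarith))

theorem MemSchatten.mul_right {p : ℝ} (hp : 0 < p) {T : H →L[ℂ] H} (hT : MemSchatten p T)
    (Z : H →L[ℂ] H) {c : ℝ} (hZ : ‖Z‖ ≤ c) :
    MemSchatten p (T * Z) ∧ schNorm p (T * Z) ≤ c * schNorm p T := by
  have hc : 0 ≤ c := (norm_nonneg Z).trans hZ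
  have hle (j : ℕ) : sVal (T * Z) j ^ p ≤ c ^ p * sVal T j ^ p := by
    rw [← Real.mul_rpow hc (sVal_nonneg T j)]
    exact Real.rpow_le_rpow (sVal_nonneg _ j) (sVal_mul_le T Z hZ j) hp.le
  have hsum : Summable fun j => c ^ p * sVal T j ^ p := Summable.mul_left _ hT
  have hnonneg (j : ℕ) : 0 ≤ sVal (T * Z) j ^ p := Real.rpow_nonneg (sVal_nonneg _ j) p
  have hmem : MemSchatten p (T * Z) := Summable.of_nonneg_of_le hnonneg hle hsum
  refine ⟨hmem, ?_⟩
  calc schNorm p (T * Z) ≤ (∑' j, c ^ p * sVal T j ^ p) ^ (1 / p) :=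
        Real.rpow_le_rpow (tsum_nonneg hnonneg) (hmem.tsum_le_tsum hle hsum) (by positivity)
    _ = c * schNorm p T := by
        rw [tsum_mul_left, Real.mul_rpow (Real.rpow_nonneg hc p)
          (tsum_nonneg fun j => Real.rpow_nonneg (sVal_nonneg T j) p), one_div,
          Real.rpow_rpow_inv hc hp.ne', schNorm, one_div]

theorem MemSchatten.isCompactOperator {p : ℝ} (hp : 0 < p) {T : H →L[ℂ] H}
    (hT : MemSchatten p T) : IsCompactOperator T := by
  refine isClosed_setOfPred_isCompactOperator.closure_subset
    (Metric.mem_closure_iff.mpr fun ε hε => ?_)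
  have hlim : ∀ᶠ j in Filter.atTop, sVal T j ^ p < ε ^ p :=
    hT.tendsto_atTop_zero.eventually_lt_const (Real.rpow_pos_of_pos hε p)
  obtain ⟨j, hj⟩ := hlim.exists
  obtain ⟨R, hR, hlt⟩ := exists_norm_sub_lt_of_sVal_lt
    ((Real.rpow_lt_rpow_iff (sVal_nonneg T j) hε.le hp).mp hj)
  exact ⟨R, isCompactOperator_of_rank_le hR, by rwa [dist_eq_norm]⟩

end SingularValues

section UnitarySquareRoot

variable {H : Type*} [NormedAddCommGroup H] [InnerProductSpace ℂ H] [CompleteSpace H]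

open Module End Filter Topology

theorem inner_map_map_of_mem_unitary {W : H →L[ℂ] H} (hW : W ∈ unitary (H →L[ℂ] H)) (x y : H) :
    inner ℂ (W x) (W y) = inner ℂ x y := by
  rw [← ContinuousLinearMap.adjoint_inner_right, ← ContinuousLinearMap.star_eq_adjoint,
    ← mul_apply_eq_comp, Unitary.star_mul_self_of_mem hW, one_apply_eq_self]

/-- If `W` is unitary and `1 - W` is compact, then `-1` is not an accumulation point of the
spectrum of `W`. -/
theorem eventually_mem_spectrum_imp_eq_neg_one {W : H →L[ℂ] H}
    (hW : W ∈ unitary (H →L[ℂ] H)) (hc : IsCompactOperator (1 - W : H →L[ℂ] H)) :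
    ∀ᶠ z in 𝓝 (-1 : ℂ), z ∈ spectrum ℂ W → z = -1 := by
  let K : Submodule ℂ H := LinearMap.ker (W + 1 : H →L[ℂ] H).toLinearMap
  have hK (k : H) : k ∈ K ↔ W k = -k := by
    simp [K, LinearMap.mem_ker, add_eq_zero_iff_eq_neg]
  have : CompleteSpace K := (W + 1 : H →L[ℂ] H).isClosed_ker.completeSpace_coe
  let T : H →L[ℂ] H := (1 - W) * (1 - K.starProjection)
  have hT : IsCompactOperator T := hc.comp_clm (1 - K.starProjection)
  have hTapply (x : H) (hx : x ∈ Kᗮ) : T x = x - W x := by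
    simp [T, K.starProjection_apply_eq_zero_iff.mpr hx]
  have hmap (y : H) (hy : y ∈ Kᗮ) : W y ∈ Kᗮ := by
    intro k hk
    have := inner_map_map_of_mem_unitary hW k y
    rw [(hK k).mp hk, inner_neg_left, hy k hk, neg_eq_zero] at this
    exact this
  have hres : (2 : ℂ) ∈ resolventSet ℂ T := by
    refine (hT.hasEigenvalue_or_mem_resolventSet two_ne_zero).resolve_left fun h => ?_
    obtain ⟨x, hx⟩ := h.exists_hasEigenvector
    have hTx : T x = (2 : ℂ) • x := hx.apply_eq_smul
    have hy : x - K.starProjection x ∈ Kᗮ := K.sub_starProjection_mem_orthogonal x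
    have hx2 : (2 : ℂ) • x ∈ Kᗮ := by
      rw [← hTx]
      exact sub_mem hy (hmap _ hy)
    have hxK : x ∈ Kᗮ := (Submodule.smul_mem_iff _ two_ne_zero).mp hx2
    rw [hTapply x hxK, two_smul] at hTx
    have hWx : W x = -x := by
      have : W x = x - (x - W x) := by abel
      rw [this, hTx]; abel
    exact hx.2 (inner_self_eq_zero.mp (hxK x ((hK x).mpr hWx)))
  have hnear : ∀ᶠ z in 𝓝 (-1 : ℂ), 1 - z ∈ resolventSet ℂ T := by
    have hcont : Tendsto (fun z : ℂ => 1 - z) (𝓝 (-1)) (𝓝 2) := by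
      have : ContinuousAt (fun z : ℂ => 1 - z) (-1) := by fun_prop
      convert this.tendsto using 2
      norm_num
    exact hcont ((spectrum.isOpen_resolventSet T).mem_nhds hres)
  have hne : ∀ᶠ z in 𝓝 (-1 : ℂ), z ≠ 1 := isOpen_ne.mem_nhds (by norm_num)
  filter_upwards [hnear, hne] with z hz hz1 hzW
  by_contra hzne
  have hspec : 1 - z ∈ spectrum ℂ (1 - W) := by
    have h := spectrum.singleton_sub_eq W (1 : ℂ)
    rw [map_one] at h
    exact h ▸ Set.sub_mem_sub rfl hzW
  have h1z : (1 : ℂ) - z ≠ 0 := sub_ne_zero.mpr hz1.symm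
  obtain ⟨v, hv⟩ := ((hc.hasEigenvalue_iff_mem_spectrum h1z).mpr hspec).exists_hasEigenvector
  have hWv : v - W v = (1 - z) • v := hv.apply_eq_smul
  have hWv' : W v = z • v := by
    have : W v = v - (v - W v) := by abel
    rw [this, hWv]; module
  have hvK : v ∈ Kᗮ := by
    intro k hk
    have := inner_map_map_of_mem_unitary hW k v
    rw [(hK k).mp hk, hWv', inner_neg_left, inner_smul_right] at this
    have h0 : (z + 1) * inner ℂ k v = 0 := by linear_combination -this
    exact (mul_eq_zero.mp h0).resolve_left fun h => hzne (eq_neg_of_add_eq_zero_left h)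
  have hTv : T v = (1 - z) • v := (hTapply v hvK).trans hWv
  have hev : HasEigenvalue (T : End ℂ H) (1 - z) :=
    hasEigenvalue_of_hasEigenvector (hasEigenvector_iff.mpr ⟨mem_eigenspace_iff.mpr hTv, hv.2⟩)
  exact (hT.hasEigenvalue_iff_mem_spectrum h1z).mp hev hz

theorem Complex.re_cpow_two_inv_nonneg (z : ℂ) : 0 ≤ (z ^ (2⁻¹ : ℂ)).re := by
  rcases eq_or_ne z 0 with rfl | hz
  · simp
  rw [Complex.cpow_def_of_ne_zero hz, Complex.exp_re]
  refine mul_nonneg (Real.exp_pos _).le (Real.cos_nonneg_of_mem_Icc ?_)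
  have him : (Complex.log z * 2⁻¹).im = Complex.arg z / 2 := by
    rw [← div_eq_mul_inv, Complex.div_ofNat_im, Complex.log_im]
  rw [him]
  constructor <;> linarith [Complex.arg_le_pi z, Complex.neg_pi_lt_arg z]

/-- A unitary `W` with `1 - W` compact has a unitary square root `X` such that `1 + X` is
invertible with inverse `Y` of norm at most `π / 4`. -/
theorem exists_unitary_sqrt {W : H →L[ℂ] H}
    (hW : W ∈ unitary (H →L[ℂ] H)) (hc : IsCompactOperator (1 - W : H →L[ℂ] H)) :
    ∃ X ∈ unitary (H →L[ℂ] H), ∃ Y : H →L[ℂ] H,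
      X * X = W ∧ (1 - W) * Y = 1 - X ∧ ‖Y‖ ≤ Real.pi / 4 := by
  have hnormal : IsStarNormal W := isStarNormal_of_mem_unitary hW
  let f : ℂ → ℂ := fun z => z ^ (2⁻¹ : ℂ)
  have hff (z : ℂ) : f z * f z = z := by
    rw [← sq]
    exact Complex.cpow_ofNat_inv_pow z 2
  have hnorm (z : ℂ) (hz : z ∈ spectrum ℂ W) : ‖z‖ = 1 :=
    norm_eq_of_mem_sphere (⟨z, spectrum.subset_circle_of_unitary hW hz⟩ : Metric.sphere (0 : ℂ) 1)
  have hfnorm (z : ℂ) (hz : z ∈ spectrum ℂ W) : ‖f z‖ = 1 := by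
    have h := congrArg norm (hff z)
    rw [norm_mul, hnorm z hz] at h
    nlinarith [norm_nonneg (f z)]
  have hf : ContinuousOn f (spectrum ℂ W) := by
    intro z hz
    rcases eq_or_ne z (-1) with rfl | hne
    · refine (continuousWithinAt_singleton (f := f) (x := -1)).mono_of_mem_nhdsWithin ?_
      rw [mem_nhdsWithin_iff_eventually]
      exact eventually_mem_spectrum_imp_eq_neg_one hW hc
    · refine ContinuousAt.continuousWithinAt (continuousAt_cpow_const ?_)
      rw [Complex.mem_slitPlane_iff]
      by_contra! h
      have hsq : z.re * z.re + z.im * z.im = 1 := by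
        rw [← Complex.normSq_apply, Complex.normSq_eq_norm_sq, hnorm z hz, one_pow]
      have hre : z.re = -1 := by
        rw [h.2] at hsq
        nlinarith [h.1]
      exact hne (Complex.ext (by simpa using hre) (by simpa using h.2))
  have hge (z : ℂ) (hz : z ∈ spectrum ℂ W) : 4 / Real.pi ≤ ‖1 + f z‖ := by
    have hre : 0 ≤ (f z).re := Complex.re_cpow_two_inv_nonneg z
    have h1 : ‖1 + f z‖ ^ 2 = 2 + 2 * (f z).re := by
      have h2 : ‖f z‖ ^ 2 = 1 := by rw [hfnorm z hz]; norm_num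
      rw [Complex.sq_norm, Complex.normSq_apply] at h2 ⊢
      simp only [Complex.add_re, Complex.one_re, Complex.add_im, Complex.one_im]
      linarith
    rw [← abs_of_nonneg (norm_nonneg (1 + f z)), ← abs_of_pos (show 0 < 4 / Real.pi by positivity),
      ← sq_le_sq, h1, div_pow, div_le_iff₀ (by positivity)]
    nlinarith [Real.pi_gt_three, sq_nonneg Real.pi]
  have hne (z : ℂ) (hz : z ∈ spectrum ℂ W) : 1 + f z ≠ 0 :=
    norm_pos_iff.mp (lt_of_lt_of_le (by positivity) (hge z hz))
  let g : ℂ → ℂ := fun z => (1 + f z)⁻¹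
  have hg : ContinuousOn g (spectrum ℂ W) := (continuousOn_const.add hf).inv₀ hne
  refine ⟨cfc f W, ?_, cfc g W, ?_, ?_, ?_⟩
  · rw [cfc_unitary_iff f W hnormal hf]
    intro z hz
    rw [RCLike.star_def, ← Complex.normSq_eq_conj_mul_self, Complex.normSq_eq_norm_sq, hfnorm z hz]
    norm_num
  · rw [← cfc_mul f f W hf hf, funext hff]
    exact cfc_id' ℂ W
  · have h1 : (1 - W : H →L[ℂ] H) = cfc (fun z : ℂ => 1 - z) W := by
      rw [cfc_sub (fun _ : ℂ => 1) (fun z => z) W, cfc_const_one ℂ W, cfc_id' ℂ W]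
    have h2 : (1 - cfc f W : H →L[ℂ] H) = cfc (fun z : ℂ => 1 - f z) W := by
      rw [cfc_sub (fun _ : ℂ => 1) f W, cfc_const_one ℂ W]
    rw [h1, h2, ← cfc_mul (fun z : ℂ => 1 - z) g W (by fun_prop) hg]
    refine cfc_congr fun z hz => ?_
    have := hff z
    simp only [g]
    rw [← div_eq_mul_inv, div_eq_iff (hne z hz)]
    linear_combination this
  · refine norm_cfc_le (by positivity) fun z hz => ?_
    rw [norm_inv]
    have := hge z hz
    rw [inv_le_comm₀ (lt_of_lt_of_le (by positivity) this) (by positivity), inv_div]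
    exact this

end UnitarySquareRoot

theorem stmt15 (p : ℝ) (hp : 0 < p)
    (H : Type) [NormedAddCommGroup H] [InnerProductSpace ℂ H] [CompleteSpace H]
    [TopologicalSpace.SeparableSpace H]
    (U₁ U₂ : H →L[ℂ] H) (hU₁ : U₁ ∈ unitary (H →L[ℂ] H)) (hU₂ : U₂ ∈ unitary (H →L[ℂ] H))
    (hS : MemSchatten p (U₁ - U₂)) :
    ∃ V : H →L[ℂ] H, V ∈ unitary (H →L[ℂ] H) ∧
      MemSchatten p (U₁ - V) ∧ MemSchatten p (U₂ - V) ∧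
      schNorm p (U₁ - V) ≤ Real.pi / 4 * schNorm p (U₁ - U₂) ∧
      schNorm p (U₂ - V) ≤ Real.pi / 4 * schNorm p (U₁ - U₂) := by
  let W : H →L[ℂ] H := star U₁ * U₂
  have hUW : U₁ * W = U₂ := by
    rw [← mul_assoc, Unitary.mul_star_self_of_mem hU₁, one_mul]
  have hUsub : U₁ * (1 - W) = U₁ - U₂ := by rw [mul_sub, mul_one, hUW]
  have hW : W ∈ unitary (H →L[ℂ] H) := mul_mem (Unitary.star_mem hU₁) hU₂
  have hc : IsCompactOperator (1 - W : H →L[ℂ] H) := by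
    have h : (1 - W : H →L[ℂ] H) = star U₁ * (U₁ - U₂) := by
      rw [mul_sub, Unitary.star_mul_self_of_mem hU₁]
    rw [h]
    exact (hS.isCompactOperator hp).clm_comp (star U₁)
  obtain ⟨X, hX, Y, hXX, hY, hYnorm⟩ := exists_unitary_sqrt hW hc
  have h₁ : U₁ - U₁ * X = (U₁ - U₂) * Y := by
    rw [← hUsub, mul_assoc, hY, mul_sub, mul_one]
  have h₂ : U₂ - U₁ * X = (U₁ - U₂) * -(Y * X) := by
    rw [mul_neg, ← mul_assoc, ← h₁, ← hUW, ← hXX]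
    noncomm_ring
  have hYX : ‖-(Y * X)‖ ≤ Real.pi / 4 := by
    rw [norm_neg, CStarRing.norm_mul_mem_unitary Y hX]
    exact hYnorm
  have hb₁ := hS.mul_right hp Y hYnorm
  have hb₂ := hS.mul_right hp (-(Y * X)) hYX
  rw [← h₁] at hb₁
  rw [← h₂] at hb₂
  exact ⟨U₁ * X, mul_mem hU₁ hX, hb₁.1, hb₂.1, hb₁.2, hb₂.2⟩
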